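/- Let e ≥ 1 and k be natural numbers with k < 2^(e-1). Suppose that (i) the rational number S₁ = ∑_{i=0}^{k} ( C(2^e+2k+1, i)⁻¹ − C(2k+1, i)⁻¹ ) is zero or satisfies ν(S₁) ≥ e − 2·lg(k+2) + 2·ν(k+1), and (ii) the rational number S₂ = ∑_{i=k+1}^{2^(e-1)+k} C(2^e+2k+1, i)⁻¹ is zero or satisfies ν(S₂) ≥ e − 2·lg(k+3) + 2·ν(k+1) − 1. Then either f(2^e+2k+1) = f(2k+1) or ν( f(2^e+2k+1) − f(2k+1) ) ≥ e − 2·lg(k+3) + 2·ν(k+1). -/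

import Mathlib

theorem half_sum (m : ℕ) :
    ∑ i ∈ Finset.range (2 * m + 1 + 1), (((2 * m + 1).choose i : ℚ))⁻¹ =
      2 * ∑ i ∈ Finset.range (m + 1), (((2 * m + 1).choose i : ℚ))⁻¹ := by
  have h2 : 2 * m + 1 + 1 = (m + 1) + (m + 1) := by ring
  rw [h2, Finset.sum_range_add, two_mul (∑ i ∈ Finset.range (m + 1), _)]
  congr 1
  rw [← Finset.sum_range_reflect]
  apply Finset.sum_congr rfl
  intro i hi
  have hi' := Finset.mem_range.mp hi
  have h3 : m + 1 + (m + 1 - 1 - i) = 2 * m + 1 - i := by omega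
  rw [h3, Nat.choose_symm (by omega)]

theorem val_add (x y : ℚ) (c : ℤ) (hx : x = 0 ∨ padicValRat 2 x ≥ c)
    (hy : y = 0 ∨ padicValRat 2 y ≥ c) : x + y = 0 ∨ padicValRat 2 (x + y) ≥ c := by
  rcases hx with rfl | hx
  · simpa using hy
  rcases hy with rfl | hy
  · right; simpa using hx
  by_cases h : x + y = 0
  · exact Or.inl h
  · right
    have := padicValRat.min_le_padicValRat_add (p := 2) h
    exact le_trans (le_min hx hy) this

/-- Proposition: statements i and ii imply Conjecture 1.3 for (e,k).
Here f(n) = ∑_{i=0}^n C(n,i)⁻¹ in ℚ, ν = 2-adic valuation, lg = ⌊log₂⌋. -/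
theorem stmt_3 (e k : ℕ) (he : 1 ≤ e) (hk : k < 2 ^ (e - 1))
    (f : ℕ → ℚ)
    (hf : ∀ n : ℕ, f n = ∑ i ∈ Finset.range (n + 1), ((n.choose i : ℚ))⁻¹)
    (hi : (∑ i ∈ Finset.range (k + 1),
        ((((2 ^ e + 2 * k + 1).choose i : ℚ))⁻¹ - (((2 * k + 1).choose i : ℚ))⁻¹)) = 0 ∨
      padicValRat 2 (∑ i ∈ Finset.range (k + 1),
        ((((2 ^ e + 2 * k + 1).choose i : ℚ))⁻¹ - (((2 * k + 1).choose i : ℚ))⁻¹)) ≥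
        (e : ℤ) - 2 * (Nat.log 2 (k + 2) : ℤ) + 2 * (padicValNat 2 (k + 1) : ℤ))
    (hii : (∑ i ∈ Finset.Icc (k + 1) (2 ^ (e - 1) + k),
        (((2 ^ e + 2 * k + 1).choose i : ℚ))⁻¹) = 0 ∨
      padicValRat 2 (∑ i ∈ Finset.Icc (k + 1) (2 ^ (e - 1) + k),
        (((2 ^ e + 2 * k + 1).choose i : ℚ))⁻¹) ≥
        (e : ℤ) - 2 * (Nat.log 2 (k + 3) : ℤ) + 2 * (padicValNat 2 (k + 1) : ℤ) - 1) :
    f (2 ^ e + 2 * k + 1) = f (2 * k + 1) ∨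
      padicValRat 2 (f (2 ^ e + 2 * k + 1) - f (2 * k + 1)) ≥
        (e : ℤ) - 2 * (Nat.log 2 (k + 3) : ℤ) + 2 * (padicValNat 2 (k + 1) : ℤ) := by
  have hS : f (2 ^ e + 2 * k + 1) - f (2 * k + 1) =
      2 * ((∑ i ∈ Finset.range (k + 1),
        ((((2 ^ e + 2 * k + 1).choose i : ℚ))⁻¹ - (((2 * k + 1).choose i : ℚ))⁻¹)) +
      ∑ i ∈ Finset.Icc (k + 1) (2 ^ (e - 1) + k),
        (((2 ^ e + 2 * k + 1).choose i : ℚ))⁻¹) := by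
    have he2 : 2 ^ e + 2 * k + 1 = 2 * (2 ^ (e - 1) + k) + 1 := by
      obtain ⟨d, rfl⟩ : ∃ d, e = d + 1 := ⟨e - 1, by omega⟩
      simp only [Nat.add_sub_cancel]; ring
    rw [hf, hf, he2, half_sum, half_sum, Finset.sum_sub_distrib]
    have hI : Finset.Icc (k + 1) (2 ^ (e - 1) + k) =
        Finset.Ico (k + 1) (2 ^ (e - 1) + k + 1) := by
      ext i; simp only [Finset.mem_Icc, Finset.mem_Ico]; omega
    rw [hI, ← Finset.sum_range_add_sum_Ico _ (show k + 1 ≤ 2 ^ (e - 1) + k + 1 by omega)]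
    ring
  have hl : (Nat.log 2 (k + 2) : ℤ) ≤ (Nat.log 2 (k + 3) : ℤ) := by
    exact_mod_cast Nat.log_mono_right (by omega)
  have key := val_add _ _ ((e : ℤ) - 2 * (Nat.log 2 (k + 3) : ℤ)
    + 2 * (padicValNat 2 (k + 1) : ℤ) - 1) (hi.imp id (fun h => by linarith)) hii
  rw [← sub_eq_zero, hS]
  by_cases h0 : (∑ i ∈ Finset.range (k + 1),
        ((((2 ^ e + 2 * k + 1).choose i : ℚ))⁻¹ - (((2 * k + 1).choose i : ℚ))⁻¹)) +
      ∑ i ∈ Finset.Icc (k + 1) (2 ^ (e - 1) + k),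
        (((2 ^ e + 2 * k + 1).choose i : ℚ))⁻¹ = 0
  · left; rw [h0, mul_zero]
  · right
    have h1 := key.resolve_left h0
    have h2 : padicValRat 2 (2 : ℚ) = 1 := by
      exact_mod_cast padicValRat.self (p := 2) (by norm_num)
    rw [padicValRat.mul (by norm_num) h0, h2]
    linarith
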